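/- Let G = {{1,2},{1,3},{1,4},{2,3},{2,4},{3,4,5}} be a family of subsets of {1,…,5} and let P = {A ⊆ {1,…,5} : g ⊆ A for some g ∈ G} (the set of supports of squarefree monomials in the ideal L^σ = (x₁x₂, x₁x₃, x₁x₄, x₂x₃, x₂x₄, x₃x₄x₅) ⊂ K[x₁,…,x₅]). Then there is no finite family of pairs (B_j, C_j) with B_j ⊆ C_j, B_j ∈ P, C_j ∈ P and |C_j| ≥ 4 for all j, such that the intervals {A : B_j ⊆ A ⊆ C_j} are pairwise disjoint and their union is all of P. (By the Herzog–Vladoiu–Zheng criterion, this says sdepth(L^σ) ≤ 3, so sdepth(L^σ) = 3 < hdepth(L^σ) = 4; Remark 2.11.) -/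

import Mathlib

/-- The generators of `L^σ = (x₁x₂, x₁x₃, x₁x₄, x₂x₃, x₂x₄, x₃x₄x₅)`, as subsets of
`{1,…,5}` (here `Fin 5`, zero-indexed). -/
def stmt16G : Finset (Finset (Fin 5)) :=
  {{0, 1}, {0, 2}, {0, 3}, {1, 2}, {1, 3}, {2, 3, 4}}

/-- The generators in `stmt16G` form an antichain. -/
theorem eq_of_subset_of_mem_stmt16G :
    ∀ g ∈ stmt16G, ∀ h ∈ stmt16G, g ⊆ h → g = h := by
  decide

/-- Every generator in `stmt16G` has at most four elements. -/
theorem card_le_four_of_mem_stmt16G : ∀ g ∈ stmt16G, g.card ≤ 4 := by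
  decide

/-- Remark 2.11: the family `P` of supports of squarefree monomials of `L^σ` admits no
partition into intervals `[B_j, C_j]` with `B_j, C_j ∈ P` and `|C_j| ≥ 4`; by the
Herzog–Vladoiu–Zheng criterion, `sdepth(L^σ) ≤ 3 < hdepth(L^σ) = 4`. -/
theorem stmt_16 :
    ¬ ∃ Part : Finset (Finset (Fin 5) × Finset (Fin 5)),
      (∀ p ∈ Part, p.1 ⊆ p.2 ∧ (∃ g ∈ stmt16G, g ⊆ p.1) ∧ (∃ g ∈ stmt16G, g ⊆ p.2) ∧
        4 ≤ p.2.card) ∧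
      (∀ p ∈ Part, ∀ q ∈ Part, p ≠ q →
        ∀ A : Finset (Fin 5), ¬((p.1 ⊆ A ∧ A ⊆ p.2) ∧ (q.1 ⊆ A ∧ A ⊆ q.2))) ∧
      (∀ A : Finset (Fin 5), (∃ g ∈ stmt16G, g ⊆ A) ↔ ∃ p ∈ Part, p.1 ⊆ A ∧ A ⊆ p.2) := by
  rintro ⟨Part, hP, hdisj, hcov⟩
  -- Each generator is the bottom of an interval, and that interval contains a 4-element set.
  have key : ∀ g ∈ stmt16G, ∃ D : Finset (Fin 5), D.card = 4 ∧
      ∃ p ∈ Part, p.1 = g ∧ p.1 ⊆ D ∧ D ⊆ p.2 := by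
    intro g hg
    obtain ⟨p, hp, hpg, hgp⟩ := (hcov g).1 ⟨g, hg, subset_rfl⟩
    obtain ⟨-, ⟨h, hh, hhp⟩, -, hcard⟩ := hP p hp
    have hhg : h = g := eq_of_subset_of_mem_stmt16G h hh g hg (hhp.trans hpg)
    have hpeq : p.1 = g := hpg.antisymm (hhg ▸ hhp)
    obtain ⟨D, hgD, hDp, hD⟩ := Finset.exists_subsuperset_card_eq hgp
      (card_le_four_of_mem_stmt16G g hg) hcard
    exact ⟨D, hD, p, hp, hpeq, hpeq ▸ hgD, hDp⟩
  choose! D hD p hp hpg hpD hDp using key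
  have hmaps : ∀ g ∈ stmt16G, D g ∈ Finset.powersetCard 4 (Finset.univ : Finset (Fin 5)) :=
    fun g hg => Finset.mem_powersetCard.2 ⟨Finset.subset_univ _, hD g hg⟩
  have hlt : (Finset.powersetCard 4 (Finset.univ : Finset (Fin 5))).card < stmt16G.card := by
    decide
  obtain ⟨g, hg, h, hh, hne, heq⟩ := Finset.exists_ne_map_eq_of_card_lt_of_maps_to hlt hmaps
  refine hdisj (p g) (hp g hg) (p h) (hp h hh) ?_ (D g)
    ⟨⟨hpD g hg, hDp g hg⟩, heq ▸ hpD h hh, heq ▸ hDp h hh⟩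
  intro hpp
  exact hne (by rw [← hpg g hg, ← hpg h hh, hpp])
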